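/- arXiv:1805.05293 — 4 statements merged into one kernel-verified Lean document; each statement's English description precedes it below -/
import Mathlib

section
/- Let n ≥ 3 be an odd integer. A cardioidal starter of order n exists if and only if every prime divisor p of n has the property that the multiplicative order of 2 modulo p is congruent to 2 modulo 4. -/
/-- A starter in `ZMod n` (`n` odd): a partition of the nonzero elements of `ZMod n`
into unordered pairs such that the differences `±(s - t)` over all pairs are exactly
the nonzero elements of `ZMod n`. -/
def IsStarter (n : ℕ) (S : Finset (Sym2 (ZMod n))) : Prop :=
  (∀ s ∈ S, ¬ s.IsDiag) ∧
  (∀ s ∈ S, ∀ x ∈ s, x ≠ (0 : ZMod n)) ∧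
  (∀ x : ZMod n, x ≠ 0 → ∃! s, s ∈ S ∧ x ∈ s) ∧
  (∀ x : ZMod n, x ≠ 0 →
    ∃! s, s ∈ S ∧ ∃ a b : ZMod n, s = s(a, b) ∧ (x = a - b ∨ x = b - a))

/-- A starter is strong if the sums `s + t` over its pairs are pairwise distinct and
all nonzero. -/
def IsStrongStarter (n : ℕ) (S : Finset (Sym2 (ZMod n))) : Prop :=
  IsStarter n S ∧
  (∀ s ∈ S, ∀ a b : ZMod n, s = s(a, b) → a + b ≠ 0) ∧
  (∀ s ∈ S, ∀ t ∈ S, ∀ a b c d : ZMod n,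
    s = s(a, b) → t = s(c, d) → a + b = c + d → s = t)

/-- A starter is Skolem if it can be written as `{{sᵢ, tᵢ}}_{i=1}^{(n-1)/2}` with
`tᵢ - sᵢ ≡ i (mod n)` and `tᵢ > sᵢ` as integer representatives. -/
def IsSkolemStarter (n : ℕ) (S : Finset (Sym2 (ZMod n))) : Prop :=
  IsStarter n S ∧
  ∃ st : ℕ → ZMod n × ZMod n,
    S = (Finset.Icc 1 ((n - 1) / 2)).image (fun i => s((st i).1, (st i).2)) ∧
    ∀ i ∈ Finset.Icc 1 ((n - 1) / 2),
      (st i).2 - (st i).1 = (i : ZMod n) ∧ (st i).1.val < (st i).2.val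

/-- A starter in `ZMod n` is cardioidal if each of its pairs has the form
`{x, 2x}` for some nonzero `x`. -/
def IsCardioidal (n : ℕ) (S : Finset (Sym2 (ZMod n))) : Prop :=
  ∀ s ∈ S, ∃ x : ZMod n, x ≠ 0 ∧ s = s(x, 2 * x)

/-- A starter is skew if the sums `±(s + t)` over all its pairs are exactly the
nonzero elements of `ZMod n`. -/
def IsSkewStarter (n : ℕ) (S : Finset (Sym2 (ZMod n))) : Prop :=
  IsStarter n S ∧
  ∀ x : ZMod n, x ≠ 0 →
    ∃! s, s ∈ S ∧ ∃ a b : ZMod n, s = s(a, b) ∧ (x = a + b ∨ x = -(a + b))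

theorem two_pow_eq_neg_one_of_orderOf_eq {p m : ℕ} [Fact p.Prime] (hm : m ≠ 0)
    (h : orderOf (2 : ZMod p) = 2 * m) : (2 : ZMod p) ^ m = -1 := by
  have hsq : ((2 : ZMod p) ^ m) ^ 2 = 1 := by
    rw [← pow_mul, mul_comm, ← h, pow_orderOf_eq_one]
  rcases eq_or_eq_neg_of_sq_eq_sq _ 1 (hsq.trans (one_pow 2).symm) with h1 | h1
  · have := Nat.le_of_dvd (Nat.pos_of_ne_zero hm) (orderOf_dvd_of_pow_eq_one h1)
    omega
  · exact h1

theorem mul_dvd_pow_sub_one {y : ℤ} {p a : ℕ} (hp : (p : ℤ) ∣ y - 1) (ha : (a : ℤ) ∣ y - 1) :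
    ((p * a : ℕ) : ℤ) ∣ y ^ p - 1 := by
  rw [← geom_sum_mul y p, Nat.cast_mul]
  refine mul_dvd_mul ?_ ha
  rw [← Int.modEq_zero_iff_dvd]
  have hy : y ≡ 1 [ZMOD p] := (Int.modEq_iff_dvd.mpr hp).symm
  have hsum : ∑ i ∈ Finset.range p, y ^ i ≡ ∑ i ∈ Finset.range p, 1 [ZMOD p] :=
    Int.ModEq.sum fun i _ => by simpa using hy.pow i
  refine hsum.trans ?_
  simp

theorem exists_odd_dvd_neg_two_pow_sub_one (n : ℕ) (hodd : Odd n)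
    (h : ∀ p : ℕ, p.Prime → p ∣ n → orderOf (2 : ZMod p) % 4 = 2) :
    ∃ M : ℕ, Odd M ∧ (n : ℤ) ∣ (-2) ^ M - 1 := by
  induction n using induction_on_primes with
  | zero => simp at hodd
  | one => exact ⟨1, odd_one, by simp⟩
  | prime_mul p a hp ih =>
    rw [Nat.odd_mul] at hodd
    obtain ⟨M, hM, hdvd⟩ := ih hodd.2 fun q hq hqa => h q hq (hqa.mul_left p)
    have hord := h p hp (dvd_mul_right p a)
    have : Fact p.Prime := ⟨hp⟩
    obtain ⟨m, hm⟩ : ∃ m, orderOf (2 : ZMod p) = 2 * m := ⟨orderOf (2 : ZMod p) / 2, by omega⟩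
    have hmodd : Odd m := by rw [Nat.odd_iff]; omega
    have h2 := two_pow_eq_neg_one_of_orderOf_eq (by omega) hm
    have hpm : (p : ℤ) ∣ (-2) ^ m - 1 := by
      rw [← ZMod.intCast_zmod_eq_zero_iff_dvd]
      push_cast
      rw [hmodd.neg_pow, h2]
      ring
    refine ⟨m * M * p, (hmodd.mul hM).mul hodd.1, ?_⟩
    rw [pow_mul]
    apply mul_dvd_pow_sub_one
    · rw [pow_mul]
      exact hpm.trans (sub_one_dvd_pow_sub_one _ _)
    · rw [mul_comm m, pow_mul]
      exact hdvd.trans (sub_one_dvd_pow_sub_one _ _)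

theorem ZMod.two_mul_eq_zero_iff {n : ℕ} (hodd : Odd n) {x : ZMod n} : 2 * x = 0 ↔ x = 0 := by
  have hu : IsUnit (2 : ZMod n) := by
    have := (ZMod.isUnit_iff_coprime 2 n).mpr (Nat.coprime_two_left.mpr hodd)
    exact_mod_cast this
  exact hu.mul_right_eq_zero

theorem pow_mul_of_mul_eq_neg {R : Type*} [CommRing R] {c y : R} (h : c * y = -y) (k : ℕ) :
    c ^ k * y = (-1) ^ k * y := by
  induction k with
  | zero => simp
  | succ k ih => rw [pow_succ, mul_assoc, h, mul_neg, ih]; ring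

/-- The least representative of the orbit of `y` under multiplication by `-2`. -/
noncomputable def orbitMin {n : ℕ} (y : ZMod n) : ℕ :=
  sInf {v | ∃ k : ℕ, v = ((-2 : ZMod n) ^ k * y).val}

theorem exists_val_eq_orbitMin {n : ℕ} (y : ZMod n) :
    ∃ k : ℕ, orbitMin y = ((-2 : ZMod n) ^ k * y).val :=
  Nat.sInf_mem (s := {v | ∃ k : ℕ, v = ((-2 : ZMod n) ^ k * y).val}) ⟨_, 0, rfl⟩

theorem orbitMin_neg_two_mul {n M : ℕ} (hM : Odd M) (h : (-2 : ZMod n) ^ M = 1) (y : ZMod n) :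
    orbitMin (-2 * y) = orbitMin y := by
  unfold orbitMin
  congr 1
  ext v
  constructor
  · rintro ⟨k, rfl⟩
    exact ⟨k + 1, by rw [pow_succ, mul_assoc]⟩
  · rintro ⟨k, rfl⟩
    refine ⟨k + (M - 1), ?_⟩
    rw [← mul_assoc, ← pow_succ, add_assoc, Nat.sub_add_cancel hM.pos, pow_add, h, mul_one]

theorem orbitMin_neg_ne {n M : ℕ} (hodd : Odd n) (hM : Odd M) (h : (-2 : ZMod n) ^ M = 1)
    {y : ZMod n} (hy : y ≠ 0) : orbitMin (-y) ≠ orbitMin y := by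
  intro he
  obtain ⟨j, hj⟩ := exists_val_eq_orbitMin (-y)
  obtain ⟨k, hk⟩ := exists_val_eq_orbitMin y
  have : NeZero n := ⟨hodd.pos.ne'⟩
  have hjk : (-2 : ZMod n) ^ j * -y = (-2) ^ k * y :=
    ZMod.val_injective n (hj.symm.trans (he.trans hk))
  have hinv : (-2 : ZMod n) ^ (j * (M - 1)) * (-2) ^ j = 1 := by
    rw [← pow_add, ← Nat.mul_succ, Nat.succ_eq_add_one, Nat.sub_add_cancel hM.pos, mul_comm,
      pow_mul, h, one_pow]
  have hc : ((-2 : ZMod n) ^ (j * (M - 1)) * (-2) ^ k) * y = -y := by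
    rw [mul_assoc, ← hjk, ← mul_assoc, hinv, one_mul]
  have hpow := pow_mul_of_mul_eq_neg hc M
  rw [← pow_add, ← pow_mul, mul_comm _ M, pow_mul, h, one_pow, hM.neg_one_pow] at hpow
  exact hy ((ZMod.two_mul_eq_zero_iff hodd).mp (by linear_combination hpow))

theorem exists_alternating_predicate {n M : ℕ} (hodd : Odd n) (hM : Odd M)
    (h : (-2 : ZMod n) ^ M = 1) :
    ∃ f : ZMod n → Prop, ∀ y, y ≠ 0 → (f (-y) ↔ ¬ f y) ∧ (f (2 * y) ↔ ¬ f y) := by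
  refine ⟨fun y => orbitMin y < orbitMin (-y), fun y hy => ?_⟩
  have h1 := orbitMin_neg_two_mul hM h y
  have h2 := orbitMin_neg_two_mul hM h (-y)
  have hne := orbitMin_neg_ne hodd hM h hy
  rw [neg_mul] at h1
  rw [neg_mul_neg] at h2
  simp only [neg_neg, h1, h2]
  omega

theorem exists_cardioidal_starter {n : ℕ} (hodd : Odd n) {f : ZMod n → Prop}
    (hf : ∀ y, y ≠ 0 → (f (-y) ↔ ¬ f y) ∧ (f (2 * y) ↔ ¬ f y)) :
    ∃ S : Finset (Sym2 (ZMod n)), IsStarter n S ∧ IsCardioidal n S := by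
  classical
  have : NeZero n := ⟨hodd.pos.ne'⟩
  have hmem : ∀ s, s ∈ (Finset.univ.filter fun x : ZMod n => x ≠ 0 ∧ f x).image
      (fun x => s(x, 2 * x)) ↔ ∃ x, (x ≠ 0 ∧ f x) ∧ s(x, 2 * x) = s := by
    simp
  refine ⟨(Finset.univ.filter fun x : ZMod n => x ≠ 0 ∧ f x).image
      (fun x => s(x, 2 * x)), ⟨?_, ?_, ?_, ?_⟩, ?_⟩
  · intro s hs
    obtain ⟨x, ⟨hx, -⟩, rfl⟩ := (hmem s).mp hs
    rw [Sym2.mk_isDiag_iff]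
    intro he
    exact hx (by linear_combination -he)
  · intro s hs y hy
    obtain ⟨x, ⟨hx, -⟩, rfl⟩ := (hmem s).mp hs
    rcases Sym2.mem_iff.mp hy with rfl | rfl
    · exact hx
    · exact (ZMod.two_mul_eq_zero_iff hodd).not.mpr hx
  · intro x hx
    simp only [hmem]
    by_cases hfx : f x
    · refine ⟨s(x, 2 * x), ⟨⟨x, ⟨hx, hfx⟩, rfl⟩, Sym2.mem_mk_left _ _⟩, ?_⟩
      rintro _ ⟨⟨y, ⟨hy, hfy⟩, rfl⟩, hxy⟩
      rcases Sym2.mem_iff.mp hxy with rfl | rfl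
      · rfl
      · exact absurd hfy ((hf y hy).2.mp hfx)
    · obtain ⟨z, rfl⟩ : ∃ z, x = 2 * z := by
        obtain ⟨k, hk⟩ := hodd
        refine ⟨((k : ZMod n) + 1) * x, ?_⟩
        have h0 : ((2 * k + 1 : ℕ) : ZMod n) = 0 := hk ▸ ZMod.natCast_self n
        push_cast at h0
        linear_combination -x * h0
      have hz : z ≠ 0 := (ZMod.two_mul_eq_zero_iff hodd).not.mp hx
      have hfz : f z := by_contra fun hn => hfx ((hf z hz).2.mpr hn)
      refine ⟨s(z, 2 * z), ⟨⟨z, ⟨hz, hfz⟩, rfl⟩, Sym2.mem_mk_right _ _⟩, ?_⟩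
      rintro _ ⟨⟨y, ⟨hy, hfy⟩, rfl⟩, hxy⟩
      rcases Sym2.mem_iff.mp hxy with h | h
      · exact absurd (h ▸ hfy) hfx
      · have : z = y := by
          rw [← sub_eq_zero, ← ZMod.two_mul_eq_zero_iff hodd, mul_sub, h, sub_self]
        rw [this]
  · intro x hx
    simp only [hmem]
    have hdiff : ∀ y : ZMod n, (∃ a b : ZMod n, s(y, 2 * y) = s(a, b) ∧
        (x = a - b ∨ x = b - a)) → x = y ∨ x = -y := by
      rintro y ⟨a, b, hab, h⟩
      rcases Sym2.eq_iff.mp hab with ⟨rfl, rfl⟩ | ⟨rfl, rfl⟩ <;> rcases h with h | h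
      · right; linear_combination h
      · left; linear_combination h
      · left; linear_combination h
      · right; linear_combination h
    by_cases hfx : f x
    · refine ⟨s(x, 2 * x), ⟨⟨x, ⟨hx, hfx⟩, rfl⟩, x, 2 * x, rfl, Or.inr (by ring)⟩, ?_⟩
      rintro _ ⟨⟨y, ⟨hy, hfy⟩, rfl⟩, hxy⟩
      rcases hdiff y hxy with rfl | rfl
      · rfl
      · exact absurd hfy ((hf y hy).1.mp hfx)
    · refine ⟨s(-x, 2 * -x), ⟨⟨-x, ⟨neg_ne_zero.mpr hx, (hf x hx).1.mpr hfx⟩, rfl⟩,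
        -x, 2 * -x, rfl, Or.inl (by ring)⟩, ?_⟩
      rintro _ ⟨⟨y, ⟨hy, hfy⟩, rfl⟩, hxy⟩
      rcases hdiff y hxy with rfl | rfl
      · exact absurd hfy hfx
      · rw [neg_neg]
  · intro s hs
    obtain ⟨x, ⟨hx, -⟩, rfl⟩ := (hmem s).mp hs
    exact ⟨x, hx, rfl⟩

section Necessity

variable {n : ℕ} {S : Finset (Sym2 (ZMod n))}

theorem IsCardioidal.two_mul_mem_iff (hS : IsStarter n S) (hC : IsCardioidal n S) (hodd : Odd n)
    {x : ZMod n} (hx : 3 * x ≠ 0) : s(2 * x, 2 * (2 * x)) ∈ S ↔ s(x, 2 * x) ∉ S := by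
  have hx0 : x ≠ 0 := by rintro rfl; simp at hx
  have h2x : 2 * x ≠ 0 := (ZMod.two_mul_eq_zero_iff hodd).not.mpr hx0
  obtain ⟨s, ⟨hs, hxs⟩, huniq⟩ := hS.2.2.1 (2 * x) h2x
  constructor
  · intro h1 h2
    have he := (huniq _ ⟨h1, Sym2.mem_mk_left _ _⟩).trans (huniq _ ⟨h2, Sym2.mem_mk_right _ _⟩).symm
    rcases Sym2.eq_iff.mp he with ⟨h, -⟩ | ⟨-, h⟩
    · exact hx0 (by linear_combination h)
    · exact hx (by linear_combination h)
  · intro h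
    obtain ⟨y, -, rfl⟩ := hC s hs
    rcases Sym2.mem_iff.mp hxs with hy | hy
    · rwa [← hy] at hs
    · have : x = y := by
        rw [← sub_eq_zero, ← ZMod.two_mul_eq_zero_iff hodd, mul_sub, hy, sub_self]
      exact absurd (this ▸ hs) h

theorem IsCardioidal.neg_mem_iff (hS : IsStarter n S) (hC : IsCardioidal n S) (hodd : Odd n)
    {x : ZMod n} (hx : 3 * x ≠ 0) : s(-x, 2 * -x) ∈ S ↔ s(x, 2 * x) ∉ S := by
  have hx0 : x ≠ 0 := by rintro rfl; simp at hx
  obtain ⟨s, ⟨hs, a, b, hab, hxab⟩, huniq⟩ := hS.2.2.2 x hx0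
  constructor
  · intro h1 h2
    have he := (huniq _ ⟨h1, -x, 2 * -x, rfl, Or.inl (by ring)⟩).trans
      (huniq _ ⟨h2, x, 2 * x, rfl, Or.inr (by ring)⟩).symm
    rcases Sym2.eq_iff.mp he with ⟨h, -⟩ | ⟨h, -⟩
    · exact hx0 ((ZMod.two_mul_eq_zero_iff hodd).mp (by linear_combination -h))
    · exact hx (by linear_combination -h)
  · intro h
    obtain ⟨y, -, rfl⟩ := hC s hs
    have hy : x = y ∨ -x = y := by
      rcases Sym2.eq_iff.mp hab with ⟨rfl, rfl⟩ | ⟨rfl, rfl⟩ <;> rcases hxab with h | h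
      · right; linear_combination -h
      · left; linear_combination h
      · left; linear_combination h
      · right; linear_combination -h
    rcases hy with rfl | rfl
    · exact absurd hs h
    · exact hs

theorem IsCardioidal.two_pow_mul_mem_iff (hS : IsStarter n S) (hC : IsCardioidal n S)
    (hodd : Odd n) {x : ZMod n} (hx : 3 * x ≠ 0) (k : ℕ) :
    s(2 ^ k * x, 2 * (2 ^ k * x)) ∈ S ↔ (s(x, 2 * x) ∈ S ↔ Even k) := by
  have hne : ∀ k : ℕ, 3 * (2 ^ k * x) ≠ 0 := by
    intro k
    induction k with
    | zero => simpa using hx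
    | succ k ih =>
      intro h0
      exact ih ((ZMod.two_mul_eq_zero_iff hodd).mp (by rw [← h0]; ring))
  induction k with
  | zero => simp
  | succ k ih =>
    have h := hC.two_mul_mem_iff hS hodd (hne k)
    rw [pow_succ', mul_assoc, Nat.even_add_one]
    tauto

end Necessity

theorem ZMod.intCast_mul_natCast_eq_zero_iff {p m : ℕ} [NeZero p] (hm : m ≠ 0) (z : ℤ) :
    (z : ZMod (p * m)) * (m : ZMod (p * m)) = 0 ↔ (z : ZMod p) = 0 := by
  have : NeZero (p * m) := ⟨mul_ne_zero (NeZero.ne p) hm⟩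
  have h : (z : ZMod (p * m)) * (m : ZMod (p * m)) = ((z * m : ℤ) : ZMod (p * m)) := by
    push_cast; rfl
  rw [h, ZMod.intCast_zmod_eq_zero_iff_dvd, ZMod.intCast_zmod_eq_zero_iff_dvd, Nat.cast_mul]
  exact mul_dvd_mul_iff_right (by exact_mod_cast hm)

theorem IsCardioidal.orderOf_two_mod_four {n : ℕ} {S : Finset (Sym2 (ZMod n))}
    (hS : IsStarter n S) (hC : IsCardioidal n S) (hodd : Odd n) {p : ℕ} (hp : p.Prime)
    (hpn : p ∣ n) : orderOf (2 : ZMod p) % 4 = 2 := by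
  have : Fact p.Prime := ⟨hp⟩
  by_cases hp3 : p = 3
  · subst hp3
    have hord : orderOf (2 : ZMod 3) = 2 := 
      orderOf_eq_prime (by decide +revert) (by decide +revert)
    rw [hord]
  obtain ⟨m, rfl⟩ := hpn
  have hm : m ≠ 0 := by rintro rfl; simp at hodd
  have hzero := ZMod.intCast_mul_natCast_eq_zero_iff (p := p) hm
  have hx : 3 * (m : ZMod (p * m)) ≠ 0 := by
    intro h
    have h3 := (hzero 3).mp (by exact_mod_cast h)
    rw [ZMod.intCast_zmod_eq_zero_iff_dvd] at h3
    exact hp3 ((Nat.prime_dvd_prime_iff_eq hp Nat.prime_three).mp (by exact_mod_cast h3))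
  have hpow := hC.two_pow_mul_mem_iff hS hodd hx
  have heven : Even (orderOf (2 : ZMod p)) := by
    have h := (hzero (2 ^ orderOf (2 : ZMod p) - 1)).mpr (by
      push_cast
      rw [pow_orderOf_eq_one, sub_self])
    push_cast at h
    have h' := hpow (orderOf (2 : ZMod p))
    rw [sub_mul, one_mul, sub_eq_zero] at h
    rw [h] at h'
    tauto
  obtain ⟨k, hk⟩ := heven
  have h2 : IsUnit (2 : ZMod p) := by
    have := (ZMod.isUnit_iff_coprime 2 p).mpr
      (Nat.coprime_two_left.mpr (Nat.odd_mul.mp hodd).1)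
    exact_mod_cast this
  have hpos : 0 < orderOf (2 : ZMod p) := by
    rw [orderOf_pos_iff]
    exact isOfFinOrder_iff_isUnit.mpr h2
  have hneg := two_pow_eq_neg_one_of_orderOf_eq (m := k) (by omega) (by omega)
  have hkodd : ¬ Even k := by
    have h := (hzero (2 ^ k + 1)).mpr (by
      push_cast
      rw [hneg, neg_add_cancel])
    push_cast at h
    have h' := hpow k
    rw [add_mul, one_mul, add_eq_zero_iff_eq_neg] at h
    rw [h, hC.neg_mem_iff hS hodd hx] at h'
    tauto
  rw [Nat.even_iff] at hkodd
  omega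

/-- A cardioidal starter of order `n` exists iff every prime divisor `p` of `n`
has multiplicative order of `2` modulo `p` congruent to `2` modulo `4`. -/
theorem cardioidal_starter_iff (n : ℕ) (hn : 3 ≤ n) (hodd : Odd n) :
    (∃ S : Finset (Sym2 (ZMod n)), IsStarter n S ∧ IsCardioidal n S) ↔
      (∀ p : ℕ, p.Prime → p ∣ n → orderOf (2 : ZMod p) % 4 = 2) := by
  constructor
  · rintro ⟨S, hS, hC⟩ p hp hpn
    exact hC.orderOf_two_mod_four hS hodd hp hpn
  · intro h
    obtain ⟨M, hM, hdvd⟩ := exists_odd_dvd_neg_two_pow_sub_one n hodd h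
    have hone : (-2 : ZMod n) ^ M = 1 := by
      have : NeZero n := ⟨hodd.pos.ne'⟩
      rw [← ZMod.intCast_zmod_eq_zero_iff_dvd] at hdvd
      push_cast at hdvd
      exact sub_eq_zero.mp hdvd
    obtain ⟨f, hf⟩ := exists_alternating_predicate hodd hM hone
    exact exists_cardioidal_starter hodd hf
end

section
/- Let n > 1 be an integer all of whose prime divisors p satisfy that the multiplicative order of 2 modulo p is congruent to 2 modulo 4. Then there exists an odd positive integer λ with 2^λ ≡ −1 (mod n), and the multiplicative order of 2 modulo n is congruent to 2 modulo 4. -/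
/-- If `a` and the odd number `p` both divide `x + 1`, then `p * a` divides `x ^ p + 1`. -/
lemma mul_dvd_pow_add_one {p : ℕ} (hp : Odd p) {a x : ℤ} (ha : a ∣ x + 1) (hx : (p : ℤ) ∣ x + 1) :
    (p : ℤ) * a ∣ x ^ p + 1 := by
  have hx' : (p : ℤ) ∣ x - (-1) := by simpa using hx
  have hsum := (Commute.all x (-1)).geom_sum₂_mul p
  rw [hp.neg_one_pow, sub_neg_eq_add, sub_neg_eq_add] at hsum
  rw [← hsum]
  exact mul_dvd_mul (dvd_geom_sum₂_self hx') ha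

lemma dvd_pow_add_one_of_dvd {a x : ℤ} {k : ℕ} (hk : Odd k) (ha : a ∣ x + 1) : a ∣ x ^ k + 1 :=
  ha.trans (by simpa using hk.add_dvd_pow_add_pow x 1)

lemma exists_odd_prime_dvd_two_pow_add_one {p : ℕ} (hp : p.Prime)
    (h : orderOf (2 : ZMod p) % 4 = 2) : ∃ k : ℕ, Odd k ∧ (p : ℤ) ∣ 2 ^ k + 1 := by
  have : Fact p.Prime := ⟨hp⟩
  obtain ⟨k, hk⟩ : ∃ k, orderOf (2 : ZMod p) = 2 * k := ⟨orderOf (2 : ZMod p) / 2, by omega⟩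
  refine ⟨k, Nat.odd_iff.mpr (by omega), ?_⟩
  have hsq : ((2 : ZMod p) ^ k) ^ 2 = 1 := by
    rw [← pow_mul, mul_comm, ← hk, pow_orderOf_eq_one]
  have hne : (2 : ZMod p) ^ k ≠ 1 := fun h1 ↦ by
    have := Nat.le_of_dvd (by omega) (orderOf_dvd_of_pow_eq_one h1)
    omega
  have hneg := (sq_eq_one_iff.mp hsq).resolve_left hne
  rw [← ZMod.intCast_zmod_eq_zero_iff_dvd]
  push_cast
  rw [hneg, neg_add_cancel]

lemma odd_of_orderOf_two_mod_four {p : ℕ} (hp : p.Prime) (h : orderOf (2 : ZMod p) % 4 = 2) :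
    Odd p := by
  refine hp.odd_of_ne_two fun h2 ↦ ?_
  subst h2
  rw [show (2 : ZMod 2) = 0 from rfl, orderOf_zero] at h
  omega

lemma exists_odd_dvd_two_pow_add_one (n : ℕ) (hn : n ≠ 0)
    (h : ∀ p : ℕ, p.Prime → p ∣ n → orderOf (2 : ZMod p) % 4 = 2) :
    ∃ l : ℕ, Odd l ∧ (n : ℤ) ∣ 2 ^ l + 1 := by
  induction n using induction_on_primes with
  | zero => exact absurd rfl hn
  | one => exact ⟨1, odd_one, by simp⟩
  | prime_mul p a hp ih =>
    have hord := h p hp (dvd_mul_right p a)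
    have hp_odd := odd_of_orderOf_two_mod_four hp hord
    obtain ⟨k, hk, hpk⟩ := exists_odd_prime_dvd_two_pow_add_one hp hord
    obtain ⟨l, hl, hal⟩ := ih (right_ne_zero_of_mul hn) fun q hq hqa ↦ h q hq (hqa.mul_left p)
    refine ⟨l * k * p, (hl.mul hk).mul hp_odd, ?_⟩
    rw [pow_mul]
    push_cast
    refine mul_dvd_pow_add_one hp_odd ?_ ?_
    · rw [pow_mul]
      exact dvd_pow_add_one_of_dvd hk hal
    · rw [mul_comm l, pow_mul]
      exact dvd_pow_add_one_of_dvd hl hpk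

/-- An element with an odd power equal to `-1 ≠ 1` has order congruent to `2` modulo `4`. -/
lemma orderOf_mod_four_eq_two {R : Type*} [Ring R] {x : R} {l : ℕ} (hl : Odd l)
    (hx : x ^ l = -1) (hne : (-1 : R) ≠ 1) : orderOf x % 4 = 2 := by
  have hdvd : orderOf x ∣ 2 * l := orderOf_dvd_of_pow_eq_one (by
    rw [mul_comm, pow_mul, hx, neg_one_sq])
  have heven : ¬ Odd (orderOf x) := fun hodd ↦ hne <| by
    rw [← hx, ← orderOf_dvd_iff_pow_eq_one]
    exact (Nat.coprime_two_right.mpr hodd).dvd_of_dvd_mul_left hdvd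
  have hfour : ¬ 4 ∣ orderOf x := fun h4 ↦ by
    have := h4.trans hdvd
    have := Nat.odd_iff.mp hl
    omega
  rw [Nat.odd_iff] at heven
  omega

/-- Let `n > 1` be an integer all of whose prime divisors `p` satisfy
`ord_p(2) ≡ 2 (mod 4)`. Then `-1` is an odd power of `2` modulo `n`, and
`ord_n(2) ≡ 2 (mod 4)`. -/
theorem neg_one_odd_power_of_two (n : ℕ) (hn : 1 < n)
    (h : ∀ p : ℕ, p.Prime → p ∣ n → orderOf (2 : ZMod p) % 4 = 2) :
    (∃ l : ℕ, Odd l ∧ 0 < l ∧ (2 : ZMod n) ^ l = -1) ∧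
      orderOf (2 : ZMod n) % 4 = 2 := by
  obtain ⟨l, hl, hdvd⟩ := exists_odd_dvd_two_pow_add_one n (by omega) h
  have hpow : (2 : ZMod n) ^ l = -1 := by
    rw [← ZMod.intCast_zmod_eq_zero_iff_dvd] at hdvd
    push_cast at hdvd
    exact eq_neg_of_add_eq_zero_left hdvd
  have hne : (-1 : ZMod n) ≠ 1 := fun h1 ↦ by
    have h2 : ((2 : ℕ) : ZMod n) = 0 := by
      push_cast
      rw [← one_add_one_eq_two, ← neg_eq_iff_add_eq_zero, h1]
    have hle := Nat.le_of_dvd two_pos ((ZMod.natCast_eq_zero_iff 2 n).mp h2)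
    obtain rfl : n = 2 := by omega
    have := odd_of_orderOf_two_mod_four Nat.prime_two (h 2 Nat.prime_two dvd_rfl)
    exact absurd this (by decide)
  exact ⟨⟨l, hl, hl.pos, hpow⟩, orderOf_mod_four_eq_two hl hpow hne⟩
end

section
/- Let p be a prime such that the multiplicative order of 2 modulo p is congruent to 2 modulo 4. Then there exists a cardioidal starter of order p. -/
/-- If `g` has even order (or infinite order), some set `A` meets every `zpowers g`-orbit in
alternating elements. -/
theorem exists_set_mul_mem_iff_notMem {G : Type*} [CommGroup G] (g : G) (hg : Even (orderOf g)) :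
    ∃ A : Set G, ∀ x, g * x ∈ A ↔ x ∉ A := by
  let r : G → G := fun x => (x : G ⧸ Subgroup.zpowers g).out
  have hr (x : G) : r (g * x) = r x := by
    have : ((g * x : G) : G ⧸ Subgroup.zpowers g) = x := by
      rw [eq_comm, QuotientGroup.eq]
      simp [mul_comm g x]
    simp only [r, this]
  have hrep (x : G) : ∃ k : ℤ, x = r x * g ^ k := by
    have h : ((r x : G) : G ⧸ Subgroup.zpowers g) = x := Quotient.out_eq _
    obtain ⟨k, hk⟩ := Subgroup.mem_zpowers_iff.mp (QuotientGroup.eq.mp h)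
    exact ⟨k, by rw [hk, mul_inv_cancel_left]⟩
  refine ⟨{x | ∃ k : ℤ, Even k ∧ x = r x * g ^ k}, fun x => ⟨?_, fun hx => ?_⟩⟩
  · rintro ⟨k, hk, hgx⟩ ⟨l, hl, hx⟩
    rw [hr] at hgx
    have hpow : g ^ (l + 1 - k) = 1 := by
      rw [zpow_sub, zpow_add_one, mul_inv_eq_one]
      apply mul_left_cancel (a := r x)
      rw [← hgx, ← mul_assoc, ← hx, mul_comm]
    have hdvd : (2 : ℤ) ∣ l + 1 - k :=
      (Int.natCast_dvd_natCast.mpr hg.two_dvd).trans (orderOf_dvd_iff_zpow_eq_one.mpr hpow)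
    grind
  · obtain ⟨k, hk⟩ := hrep x
    have hodd : ¬ Even k := fun he => hx ⟨k, he, hk⟩
    refine ⟨k + 1, by grind, ?_⟩
    rw [hr, zpow_add_one, ← mul_assoc, ← hk, mul_comm]

/-- A set of nonzero residues containing exactly one of `x, 2x` and exactly one of `x, -x`
for all nonzero `x` yields a cardioidal starter. -/
theorem exists_cardioidal_starter_of_set {p : ℕ} [Fact p.Prime] (h2 : (2 : ZMod p) ≠ 0)
    (A : Set (ZMod p)) (h0 : 0 ∉ A) (hdouble : ∀ x, x ≠ 0 → (2 * x ∈ A ↔ x ∉ A))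
    (hneg : ∀ x, x ≠ 0 → (-x ∈ A ↔ x ∉ A)) :
    ∃ S : Finset (Sym2 (ZMod p)), IsStarter p S ∧ IsCardioidal p S := by
  classical
  have hne {x : ZMod p} (hx : x ∈ A) : x ≠ 0 := fun h => h0 (h ▸ hx)
  let S : Finset (Sym2 (ZMod p)) := (Finset.univ.filter (· ∈ A)).image fun x => s(x, 2 * x)
  have hS (s : Sym2 (ZMod p)) : s ∈ S ↔ ∃ y ∈ A, s(y, 2 * y) = s := by simp [S]
  have hdiff {y x : ZMod p} (h : ∃ a b, s(y, 2 * y) = s(a, b) ∧ (x = a - b ∨ x = b - a)) :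
      x = y ∨ x = -y := by
    obtain ⟨a, b, hab, hx⟩ := h
    rcases Sym2.eq_iff.mp hab with ⟨rfl, rfl⟩ | ⟨rfl, rfl⟩ <;> grind
  refine ⟨S, ⟨?_, ?_, ?_, ?_⟩, ?_⟩
  · intro s hs
    obtain ⟨y, hy, rfl⟩ := (hS s).mp hs
    have := hne hy
    rw [Sym2.mk_isDiag_iff]
    grind
  · intro s hs x hx
    obtain ⟨y, hy, rfl⟩ := (hS s).mp hs
    rcases Sym2.mem_iff.mp hx with rfl | rfl
    · exact hne hy
    · exact mul_ne_zero h2 (hne hy)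
  · intro x hx
    by_cases hxA : x ∈ A
    · refine ⟨s(x, 2 * x), ⟨(hS _).mpr ⟨x, hxA, rfl⟩, Sym2.mem_mk_left _ _⟩, ?_⟩
      rintro s ⟨hs, hxs⟩
      obtain ⟨y, hy, rfl⟩ := (hS s).mp hs
      rcases Sym2.mem_iff.mp hxs with rfl | rfl
      · rfl
      · exact absurd hy ((hdouble y (hne hy)).mp hxA)
    · obtain ⟨z, rfl⟩ : ∃ z, x = 2 * z := ⟨x / 2, (mul_div_cancel₀ x h2).symm⟩
      have hz : z ∈ A := by
        by_contra hz
        exact hxA ((hdouble z (right_ne_zero_of_mul hx)).mpr hz)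
      refine ⟨s(z, 2 * z), ⟨(hS _).mpr ⟨z, hz, rfl⟩, Sym2.mem_mk_right _ _⟩, ?_⟩
      rintro s ⟨hs, hxs⟩
      obtain ⟨y, hy, rfl⟩ := (hS s).mp hs
      rcases Sym2.mem_iff.mp hxs with rfl | h
      · exact absurd hy hxA
      · rw [mul_left_cancel₀ h2 h]
  · intro x hx
    obtain ⟨z, hz, hxz⟩ : ∃ z ∈ A, x = z ∨ x = -z := by
      by_cases hxA : x ∈ A
      · exact ⟨x, hxA, Or.inl rfl⟩
      · exact ⟨-x, (hneg x hx).mpr hxA, Or.inr (neg_neg x).symm⟩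
    refine ⟨s(z, 2 * z), ⟨(hS _).mpr ⟨z, hz, rfl⟩, z, 2 * z, rfl, by grind⟩, ?_⟩
    rintro s ⟨hs, hxs⟩
    obtain ⟨y, hy, rfl⟩ := (hS s).mp hs
    have hnz := (hneg z (hne hz)).not.mpr (not_not.mpr hz)
    have hyz : y = z ∨ y = -z := by
      rcases hdiff hxs with h | h <;> grind
    rcases hyz with rfl | rfl
    · rfl
    · exact absurd hy hnz
  · intro s hs
    obtain ⟨y, hy, rfl⟩ := (hS s).mp hs
    exact ⟨y, hne hy, rfl⟩

/-- For any prime `p` with `ord_p(2) ≡ 2 (mod 4)`, there exists a cardioidal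
starter of order `p`. -/
theorem cardioidal_starter_of_prime (p : ℕ) (hp : p.Prime)
    (h : orderOf (2 : ZMod p) % 4 = 2) :
    ∃ S : Finset (Sym2 (ZMod p)), IsStarter p S ∧ IsCardioidal p S := by
  have : Fact p.Prime := ⟨hp⟩
  have h2 : (2 : ZMod p) ≠ 0 := by
    intro h0
    simp [h0] at h
  obtain ⟨m, hm, hmodd⟩ : ∃ m, orderOf (2 : ZMod p) = 2 * m ∧ Odd m :=
    ⟨orderOf (2 : ZMod p) / 2, by omega, Nat.odd_iff.mpr (by omega)⟩
  have hpow : (2 : ZMod p) ^ m = -1 := by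
    have hsq : (2 : ZMod p) ^ m * 2 ^ m = 1 := by
      rw [← pow_add, ← two_mul, ← hm, pow_orderOf_eq_one]
    refine (mul_self_eq_one_iff.mp hsq).resolve_left fun h1 => ?_
    have := Nat.le_of_dvd hmodd.pos (orderOf_dvd_of_pow_eq_one h1)
    have := hmodd.pos
    omega
  obtain ⟨B, hB⟩ := exists_set_mul_mem_iff_notMem (Units.mk0 (2 : ZMod p) h2) (by
    rw [← orderOf_units, Units.val_mk0, hm]
    exact even_two_mul m)
  have hmem (u : (ZMod p)ˣ) : (u : ZMod p) ∈ Units.val '' B ↔ u ∈ B :=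
    Units.val_injective.mem_set_image
  have hdouble (x : ZMod p) (hx : x ≠ 0) : 2 * x ∈ Units.val '' B ↔ x ∉ Units.val '' B := by
    lift x to (ZMod p)ˣ using hx.isUnit
    rw [hmem, ← hB, ← hmem, Units.val_mul, Units.val_mk0]
  refine exists_cardioidal_starter_of_set h2 (Units.val '' B) ?_ hdouble fun x hx => ?_
  · rintro ⟨u, -, hu⟩
    exact u.ne_zero hu
  · have hiter (k : ℕ) : 2 ^ k * x ∈ Units.val '' B ↔ (Even k ↔ x ∈ Units.val '' B) := by
      induction k with
      | zero => simp
      | succ k ih =>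
        rw [pow_succ', mul_assoc, hdouble _ (mul_ne_zero (pow_ne_zero k h2) hx), ih,
          Nat.even_add_one]
        tauto
    rw [← neg_one_mul, ← hpow, hiter, ← Nat.not_odd_iff_even]
    tauto
end

section
/- Let n > 1 be an integer all of whose prime divisors p satisfy that the multiplicative order of 2 modulo p is congruent to 2 modulo 4. Then n ≡ 1 (mod 8) or n ≡ 3 (mod 8). -/
/-- If `2` has order congruent to `2` modulo `4` in a domain, then `-2` is a square there. -/
theorem isSquare_neg_two_of_orderOf_two_mod_four {R : Type*} [CommRing R] [NoZeroDivisors R]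
    (h : orderOf (2 : R) % 4 = 2) : IsSquare (-2 : R) := by
  obtain ⟨k, hk⟩ : ∃ k, orderOf (2 : R) = 2 * (2 * k + 1) :=
    ⟨orderOf (2 : R) / 4, by lia⟩
  have hsq : ((2 : R) ^ (2 * k + 1)) ^ 2 = 1 := by
    rw [← pow_mul, mul_comm, ← hk, pow_orderOf_eq_one]
  have hne : (2 : R) ^ (2 * k + 1) ≠ 1 := fun h1 => by
    have := Nat.le_of_dvd (by lia) (orderOf_dvd_of_pow_eq_one h1)
    lia
  have hneg := (sq_eq_one_iff.mp hsq).resolve_left hne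
  have hone : (-2 : R) ^ (2 * k + 1) = 1 := by
    rw [Odd.neg_pow ⟨k, rfl⟩, hneg, neg_neg]
  refine ⟨(-2) ^ (k + 1), ?_⟩
  calc (-2 : R) = (-2) ^ (2 * k + 1) * (-2) := by rw [hone, one_mul]
    _ = (-2) ^ (k + 1) * (-2) ^ (k + 1) := by ring

theorem Nat.Prime.mod_eight_of_orderOf_two_mod_four {p : ℕ} (hp : p.Prime)
    (h : orderOf (2 : ZMod p) % 4 = 2) : p % 8 = 1 ∨ p % 8 = 3 := by
  have : Fact p.Prime := ⟨hp⟩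
  have hp2 : p ≠ 2 := by
    rintro rfl
    have h0 : (2 : ZMod 2) = 0 := rfl
    simp [h0] at h
  exact (ZMod.exists_sq_eq_neg_two_iff hp2).mp (isSquare_neg_two_of_orderOf_two_mod_four h)

/-- The residue classes `1` and `3` modulo `8` are closed under multiplication. -/
theorem Nat.mod_eight_of_forall_prime_dvd {n : ℕ} (hn : n ≠ 0)
    (h : ∀ p : ℕ, p.Prime → p ∣ n → p % 8 = 1 ∨ p % 8 = 3) : n % 8 = 1 ∨ n % 8 = 3 := by
  induction n using induction_on_primes with
  | zero => exact absurd rfl hn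
  | one => simp
  | prime_mul p a hp ih =>
    have ha := ih (right_ne_zero_of_mul hn) fun q hq hqa => h q hq (hqa.mul_left p)
    rcases h p hp (dvd_mul_right p a) with h1 | h1 <;> rcases ha with h2 | h2 <;>
      simp [Nat.mul_mod, h1, h2]

/-- Let `n > 1` be an integer all of whose prime divisors `p` satisfy
`ord_p(2) ≡ 2 (mod 4)`. Then `n ≡ 1 (mod 8)` or `n ≡ 3 (mod 8)`. -/
theorem mod_eight_of_all_prime_divisors (n : ℕ) (hn : 1 < n)
    (h : ∀ p : ℕ, p.Prime → p ∣ n → orderOf (2 : ZMod p) % 4 = 2) :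
    n % 8 = 1 ∨ n % 8 = 3 :=
  Nat.mod_eight_of_forall_prime_dvd (by lia) fun p hp hpn =>
    hp.mod_eight_of_orderOf_two_mod_four (h p hp hpn)
end
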